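/- Let f(x,y,z) = x²y²+y²z²+z²x² − (x²+y²+z²) + 3/4 and Q = {p ∈ ℝ³ : f(p) = 0}. Then the set of singular points of Q, that is, the set of points p with f(p) = 0 at which all three partial derivatives of f vanish, is exactly the set of eight points (ε₁/√2, ε₂/√2, ε₃/√2) with ε₁, ε₂, ε₃ ∈ {−1, 1} (the vertices of a cube centered at the origin). -/

import Mathlib

/-- The quartic polynomial `v - u + 3/4` defining `Q_{(1,0,-1)}(3/4)`. -/
noncomputable def fQ4 (p : EuclideanSpace ℝ (Fin 3)) : ℝ :=
  (p 0)^2*(p 1)^2 + (p 1)^2*(p 2)^2 + (p 2)^2*(p 0)^2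
    - ((p 0)^2 + (p 1)^2 + (p 2)^2) + 3/4

theorem hasFDerivAt_fQ4 (p : EuclideanSpace ℝ (Fin 3)) :
    HasFDerivAt fQ4
      ((2 * p 0 * (p 1 ^ 2 + p 2 ^ 2 - 1)) • EuclideanSpace.proj (𝕜 := ℝ) (0 : Fin 3) +
        (2 * p 1 * (p 0 ^ 2 + p 2 ^ 2 - 1)) • EuclideanSpace.proj (𝕜 := ℝ) (1 : Fin 3) +
        (2 * p 2 * (p 0 ^ 2 + p 1 ^ 2 - 1)) • EuclideanSpace.proj (𝕜 := ℝ) (2 : Fin 3) :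
          EuclideanSpace ℝ (Fin 3) →L[ℝ] ℝ) p := by
  have h (i : Fin 3) : HasFDerivAt (fun q : EuclideanSpace ℝ (Fin 3) => q i)
      (EuclideanSpace.proj i : EuclideanSpace ℝ (Fin 3) →L[ℝ] ℝ) p :=
    (EuclideanSpace.proj i : EuclideanSpace ℝ (Fin 3) →L[ℝ] ℝ).hasFDerivAt
  have h0 := (h 0).pow 2
  have h1 := (h 1).pow 2
  have h2 := (h 2).pow 2
  refine (((((h0.mul h1).add (h1.mul h2)).add (h2.mul h0)).sub
    ((h0.add h1).add h2)).add_const (3 / 4)).congr_fderiv ?_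
  ext v
  simp
  ring

theorem fderiv_fQ4_eq_zero_iff (p : EuclideanSpace ℝ (Fin 3)) :
    fderiv ℝ fQ4 p = 0 ↔ p 0 * (p 1 ^ 2 + p 2 ^ 2 - 1) = 0 ∧
      p 1 * (p 0 ^ 2 + p 2 ^ 2 - 1) = 0 ∧ p 2 * (p 0 ^ 2 + p 1 ^ 2 - 1) = 0 := by
  rw [(hasFDerivAt_fQ4 p).fderiv]
  constructor
  · intro h
    have e (i : Fin 3) := DFunLike.congr_fun h (EuclideanSpace.single i (1 : ℝ))
    have e0 := e 0
    have e1 := e 1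
    have e2 := e 2
    simp [-mul_eq_zero] at e0 e1 e2
    exact ⟨by linarith, by linarith, by linarith⟩
  · rintro ⟨h0, h1, h2⟩
    simp only [mul_assoc, h0, h1, h2, mul_zero, zero_smul, add_zero]

theorem singular_quartic_iff (x y z : ℝ) :
    (x ^ 2 * y ^ 2 + y ^ 2 * z ^ 2 + z ^ 2 * x ^ 2 - (x ^ 2 + y ^ 2 + z ^ 2) + 3 / 4 = 0 ∧
      x * (y ^ 2 + z ^ 2 - 1) = 0 ∧ y * (x ^ 2 + z ^ 2 - 1) = 0 ∧
      z * (x ^ 2 + y ^ 2 - 1) = 0) ↔ x ^ 2 = 1 / 2 ∧ y ^ 2 = 1 / 2 ∧ z ^ 2 = 1 / 2 := by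
  constructor
  · rintro ⟨hf, hx, hy, hz⟩
    rcases mul_eq_zero.1 hx with hx | hx <;> rcases mul_eq_zero.1 hy with hy | hy <;>
      rcases mul_eq_zero.1 hz with hz | hz <;> grind
  · rintro ⟨hx, hy, hz⟩
    norm_num [hx, hy, hz]

theorem sq_eq_half_iff (x : ℝ) :
    x ^ 2 = 1 / 2 ↔ ∃ ε : ℝ, (ε = 1 ∨ ε = -1) ∧ x = ε / Real.sqrt 2 := by
  have h : (1 / 2 : ℝ) = (1 / Real.sqrt 2) ^ 2 := by norm_num [div_pow]
  rw [h, sq_eq_sq_iff_eq_or_eq_neg]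
  simp [or_and_right, exists_or, neg_div]

/-- the singular points of `Q_{(1,0,-1)}(3/4)` are the eight points
`(±1/√2, ±1/√2, ±1/√2)`, the vertices of a cube centered at the origin. -/
theorem stmt_4 :
    {p : EuclideanSpace ℝ (Fin 3) | fQ4 p = 0 ∧ fderiv ℝ fQ4 p = 0} =
      {p : EuclideanSpace ℝ (Fin 3) | ∃ ε₁ ε₂ ε₃ : ℝ,
        (ε₁ = 1 ∨ ε₁ = -1) ∧ (ε₂ = 1 ∨ ε₂ = -1) ∧ (ε₃ = 1 ∨ ε₃ = -1) ∧
        p 0 = ε₁ / Real.sqrt 2 ∧ p 1 = ε₂ / Real.sqrt 2 ∧ p 2 = ε₃ / Real.sqrt 2} := by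
  ext p
  simp only [Set.mem_ofPred_eq]
  rw [fderiv_fQ4_eq_zero_iff, fQ4, singular_quartic_iff, sq_eq_half_iff, sq_eq_half_iff,
    sq_eq_half_iff]
  constructor
  · rintro ⟨⟨a, ha, hx⟩, ⟨b, hb, hy⟩, ⟨c, hc, hz⟩⟩
    exact ⟨a, b, c, ha, hb, hc, hx, hy, hz⟩
  · rintro ⟨a, b, c, ha, hb, hc, hx, hy, hz⟩
    exact ⟨⟨a, ha, hx⟩, ⟨b, hb, hy⟩, ⟨c, hc, hz⟩⟩
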